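/- Let S ⊆ ℝ³ with projections S₁₂, S₁₃ onto coordinate planes (1,2) and (1,3), and let a, b ≥ 0 satisfy dim_p(S₁₂) + dim_p(S₁₃) ≤ a + b. Then S can be split as S = S' ∪ S'' such that dim_H(S'₁) ≤ a and dim_H(S'') ≤ b, where S'₁ is the projection of S' onto the first coordinate. -/

import Mathlib

open scoped ENNReal

/-- Extended-real logarithm of an `ℝ≥0∞` value. -/
noncomputable def elog (x : ℝ≥0∞) : EReal :=
  if x = ⊤ then (⊤ : EReal) else ((Real.log x.toReal : ℝ) : EReal)

/-- Minimal number of `ε`-balls needed to cover `s` (`⊤` if no finite cover exists). -/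
noncomputable def coveringNumber {α : Type*} [PseudoMetricSpace α] (ε : ℝ) (s : Set α) : ℝ≥0∞ :=
  ⨅ (t : Finset α) (_ : s ⊆ ⋃ x ∈ t, Metric.ball x ε), (t.card : ℝ≥0∞)

/-- Upper box (Minkowski) dimension: `limsup log N(1/n, s) / log n`. -/
noncomputable def upperBoxDim {α : Type*} [PseudoMetricSpace α] (s : Set α) : EReal :=
  Filter.limsup
    (fun n : ℕ => elog (coveringNumber (1 / n) s) * (((Real.log n)⁻¹ : ℝ) : EReal))
    Filter.atTop

/-- Packing dimension: infimum over countable covers of the supremum of the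
upper box dimensions of the pieces. -/
noncomputable def packingDim {α : Type*} [PseudoMetricSpace α] (s : Set α) : EReal :=
  ⨅ (c : ℕ → Set α) (_ : s ⊆ ⋃ n, c n), ⨆ n, upperBoxDim (c n)


open Filter MeasureTheory Topology

theorem comb_split (P Q : Finset (ℤ × ℤ)) (K : ℝ) (hK : 0 < K) :
    ∃ (H : Finset ℤ) (L : Finset (ℤ × ℤ × ℤ)), (H.card : ℝ) * K ≤ P.card * Q.card ∧
      (L.card : ℝ) ≤ K ∧
      ∀ i j k, (i, j) ∈ P → (i, k) ∈ Q → i ∈ H ∨ (i, j, k) ∈ L := by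
  classical
  let I : Finset ℤ := P.image Prod.fst ∪ Q.image Prod.fst
  let PP : ℤ → Finset (ℤ × ℤ) := fun i => P.filter (fun p => p.1 = i)
  let QQ : ℤ → Finset (ℤ × ℤ) := fun i => Q.filter (fun p => p.1 = i)
  let M : ℤ → ℝ := fun i => (PP i).card
  let N : ℤ → ℝ := fun i => (QQ i).card
  let w : ℤ → ℝ := fun i => √(M i) * √(N i)
  let R : ℝ := √(P.card) * √(Q.card)
  have hw0 : ∀ i, 0 ≤ w i := fun i => by positivity
  have hR0 : 0 ≤ R := by positivity
  have hM : ∑ i ∈ I, M i = P.card := by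
    have := Finset.card_eq_sum_card_fiberwise (f := Prod.fst) (s := P) (t := I)
      (fun x hx => by
        simp only [I, Finset.coe_union, Finset.coe_image]
        exact Or.inl ⟨x, hx, rfl⟩)
    rw [this]; push_cast; rfl
  have hN : ∑ i ∈ I, N i = Q.card := by
    have := Finset.card_eq_sum_card_fiberwise (f := Prod.fst) (s := Q) (t := I)
      (fun x hx => by
        simp only [I, Finset.coe_union, Finset.coe_image]
        exact Or.inr ⟨x, hx, rfl⟩)
    rw [this]; push_cast; rfl
  have hsum : ∑ i ∈ I, w i ≤ R := by
    have := Real.sum_sqrt_mul_sqrt_le I (f := M) (g := N) (fun i => by positivity) (fun i => by positivity)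
    rwa [hM, hN] at this
  have hRR : R * R = P.card * Q.card := by
    have h1 := Real.mul_self_sqrt (show (0:ℝ) ≤ P.card by positivity)
    have h2 := Real.mul_self_sqrt (show (0:ℝ) ≤ Q.card by positivity)
    calc R * R = (√(P.card) * √(P.card)) * (√(Q.card) * √(Q.card)) := by simp only [R]; ring
      _ = _ := by rw [h1, h2]
  have hww : ∀ i, w i * w i = M i * N i := fun i => by
    have h1 := Real.mul_self_sqrt (show (0:ℝ) ≤ M i by positivity)
    have h2 := Real.mul_self_sqrt (show (0:ℝ) ≤ N i by positivity)
    calc w i * w i = (√(M i) * √(M i)) * (√(N i) * √(N i)) := by simp only [w]; ring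
      _ = _ := by rw [h1, h2]
  let H := I.filter (fun i => K < w i * R)
  let L := (I.filter (fun i => ¬ K < w i * R)).biUnion
    (fun i => (PP i ×ˢ QQ i).image (fun z => (z.1.1, z.1.2, z.2.2)))
  refine ⟨H, L, ?_, ?_, ?_⟩
  · rw [← hRR]
    calc (H.card : ℝ) * K = ∑ i ∈ H, K := by simp
      _ ≤ ∑ i ∈ H, w i * R := Finset.sum_le_sum fun i hi => (Finset.mem_filter.1 hi).2.le
      _ ≤ ∑ i ∈ I, w i * R := Finset.sum_le_sum_of_subset_of_nonneg (Finset.filter_subset _ _)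
          (fun i _ _ => mul_nonneg (hw0 i) hR0)
      _ = (∑ i ∈ I, w i) * R := by rw [Finset.sum_mul]
      _ ≤ R * R := by gcongr
  · have h1 : (L.card : ℝ) ≤ ∑ i ∈ I.filter (fun i => ¬ K < w i * R), M i * N i := by
      calc (L.card : ℝ) ≤ ((∑ i ∈ I.filter (fun i => ¬ K < w i * R), (PP i).card * (QQ i).card : ℕ) : ℝ) := by
            norm_cast
            refine Finset.card_biUnion_le.trans (Finset.sum_le_sum fun i _ => ?_)
            exact Finset.card_image_le.trans (Finset.card_product _ _).le
        _ = _ := by push_cast; rfl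
    refine h1.trans ?_
    rcases hR0.eq_or_lt with hR | hR
    · have : ∀ i ∈ I, w i = 0 := by
        rw [← hR] at hsum
        exact (Finset.sum_eq_zero_iff_of_nonneg (fun i _ => hw0 i)).1
          (le_antisymm hsum (Finset.sum_nonneg fun i _ => hw0 i))
      rw [Finset.sum_eq_zero]
      · exact hK.le
      · intro i hi
        rw [← hww, this i (Finset.mem_filter.1 hi).1, zero_mul]
    · calc ∑ i ∈ I.filter (fun i => ¬ K < w i * R), M i * N i
          ≤ ∑ i ∈ I.filter (fun i => ¬ K < w i * R), w i * (K / R) := by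
            refine Finset.sum_le_sum fun i hi => ?_
            rw [← hww]
            have := not_lt.1 (Finset.mem_filter.1 hi).2
            exact mul_le_mul_of_nonneg_left ((le_div_iff₀ hR).2 this) (hw0 i)
        _ ≤ ∑ i ∈ I, w i * (K / R) := Finset.sum_le_sum_of_subset_of_nonneg (Finset.filter_subset _ _)
          (fun i _ _ => mul_nonneg (hw0 i) (by positivity))
        _ = (∑ i ∈ I, w i) * (K / R) := by rw [Finset.sum_mul]
        _ ≤ R * (K / R) := by gcongr
        _ = K := by field_simp
  · intro i j k hP hQ
    have hi : i ∈ I := Finset.mem_union_left _ (Finset.mem_image.2 ⟨_, hP, rfl⟩)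
    by_cases h : K < w i * R
    · exact Or.inl (Finset.mem_filter.2 ⟨hi, h⟩)
    · right
      refine Finset.mem_biUnion.2 ⟨i, Finset.mem_filter.2 ⟨hi, h⟩, Finset.mem_image.2
        ⟨((i, j), (i, k)), Finset.mem_product.2 ⟨Finset.mem_filter.2 ⟨hP, rfl⟩,
          Finset.mem_filter.2 ⟨hQ, rfl⟩⟩, rfl⟩⟩

theorem dim_limsup {X ι : Type*} [MetricSpace X] [Countable ι] (q : ℕ → X → ι)
    (hq : ∀ m x y, q m x = q m y → edist x y ≤ ENNReal.ofReal ((1/2 : ℝ) ^ m))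
    (F : ℕ → Finset ι) (C s : ℝ) (hC : 0 ≤ C) (hs : 0 ≤ s) (m0 : ℕ)
    (hF : ∀ m ≥ m0, ((F m).card : ℝ) ≤ C * 2 ^ ((m : ℝ) * s))
    (E : Set X) (hE : ∀ x ∈ E, ∃ᶠ m in atTop, q m x ∈ F m) : dimH E ≤ ENNReal.ofReal s := by
  classical
  borelize X
  refine le_of_forall_gt_imp_ge_of_dense fun t' ht' => ?_
  rcases eq_or_ne t' ⊤ with rfl | htop
  · exact le_top
  lift t' to NNReal using htop
  have hst : s < (t' : ℝ) := by
    rw [← ENNReal.ofReal_coe_nnreal] at ht'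
    exact (ENNReal.ofReal_lt_ofReal_iff_of_nonneg hs).1 ht'
  have ht0 : (0 : ℝ) < t' := hs.trans_lt hst
  refine dimH_le_of_hausdorffMeasure_ne_top ?_
  let f : ℕ → ℝ≥0∞ := fun m => ENNReal.ofReal (C * ((2:ℝ) ^ (s - t')) ^ m)
  have hρ0 : (0:ℝ) ≤ (2:ℝ) ^ (s - t') := by positivity
  have hρ1 : (2:ℝ) ^ (s - t') < 1 := Real.rpow_lt_one_of_one_lt_of_neg one_lt_two (by linarith)
  have hsummable : ∑' m, f m ≠ ⊤ := by
    have := (summable_geometric_of_lt_one hρ0 hρ1).mul_left C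
    rw [← ENNReal.ofReal_tsum_of_nonneg (fun n => by positivity) this]
    exact ENNReal.ofReal_ne_top
  let T : ℕ → ℕ × ι → Set X := fun N p =>
    if p.2 ∈ F (p.1 + N) then {x | q (p.1 + N) x = p.2} else ∅
  have hTd : ∀ N p, Metric.ediam (T N p) ≤ ENNReal.ofReal ((1/2 : ℝ) ^ (p.1 + N)) := by
    intro N p
    refine Metric.ediam_le fun x hx y hy => ?_
    simp only [T] at hx hy
    split_ifs at hx hy
    · exact hq _ _ _ (hx.trans hy.symm)
    · exact hx.elim
  have hr : Tendsto (fun N : ℕ => ENNReal.ofReal ((1/2 : ℝ) ^ N)) atTop (𝓝 0) := by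
    rw [← ENNReal.ofReal_zero]
    exact (ENNReal.continuous_ofReal.tendsto 0).comp
      (tendsto_pow_atTop_nhds_zero_of_lt_one (by norm_num) (by norm_num))
  have key := Measure.hausdorffMeasure_le_liminf_tsum (t' : ℝ) E (l := atTop)
    (fun N : ℕ => ENNReal.ofReal ((1/2 : ℝ) ^ N)) hr T
    (Eventually.of_forall fun N p => (hTd N p).trans (ENNReal.ofReal_le_ofReal
      (pow_le_pow_of_le_one (by norm_num) (by norm_num) (by omega))))
    (Eventually.of_forall fun N x hx => by
      obtain ⟨m, hm, hmF⟩ := frequently_atTop.1 (hE x hx) N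
      refine Set.mem_iUnion.2 ⟨(m - N, q m x), ?_⟩
      have : m - N + N = m := by omega
      simp only [T, this, hmF, if_true]
      rfl)
  have hbound : ∀ N ≥ m0, ∑' p, Metric.ediam (T N p) ^ (t' : ℝ) ≤ ∑' k, f (k + N) := by
    intro N hN
    rw [ENNReal.tsum_prod (f := fun k u => Metric.ediam (T N (k, u)) ^ (t' : ℝ))]
    refine ENNReal.tsum_le_tsum fun k => ?_
    have h0 : ∀ u ∉ F (k + N), Metric.ediam (T N (k, u)) ^ (t' : ℝ) = 0 := by
      intro u hu
      simp [T, hu, ht0]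
    rw [tsum_eq_sum h0]
    calc ∑ u ∈ F (k + N), Metric.ediam (T N (k, u)) ^ (t' : ℝ)
        ≤ ∑ u ∈ F (k + N), ENNReal.ofReal ((1/2 : ℝ) ^ (k + N)) ^ (t' : ℝ) :=
          Finset.sum_le_sum fun u _ => ENNReal.rpow_le_rpow (hTd N (k, u)) ht0.le
      _ = ENNReal.ofReal ((F (k+N)).card * ((1/2 : ℝ) ^ (k + N)) ^ (t' : ℝ)) := by
          rw [Finset.sum_const, nsmul_eq_mul, ENNReal.ofReal_mul (by positivity),
            ENNReal.ofReal_natCast, ENNReal.ofReal_rpow_of_nonneg (by positivity) ht0.le]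
      _ ≤ f (k + N) := by
          refine ENNReal.ofReal_le_ofReal ?_
          refine (mul_le_mul_of_nonneg_right (hF (k+N) (by omega)) (by positivity)).trans (le_of_eq ?_)
          rw [mul_assoc]
          congr 1
          generalize k + N = m
          rw [one_div, inv_pow, ← Real.rpow_natCast, ← Real.rpow_neg (by norm_num),
            ← Real.rpow_mul (by norm_num), ← Real.rpow_add (by norm_num), ← Real.rpow_natCast, ← Real.rpow_mul (by norm_num)]
          congr 1; ring
  have hlim : liminf (fun N => ∑' p, Metric.ediam (T N p) ^ (t' : ℝ)) atTop ≤ 0 := by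
    rw [← (ENNReal.tendsto_sum_nat_add f hsummable).liminf_eq]
    exact liminf_le_liminf (eventually_atTop.2 ⟨m0, hbound⟩)
  have := key.trans hlim
  intro h
  rw [h] at this
  simp at this

/-- dyadic code -/
noncomputable def dy (m : ℕ) (x : ℝ) : ℤ := ⌊x * 2 ^ m⌋

theorem dy_edist (m : ℕ) (x y : ℝ) (h : dy m x = dy m y) :
    edist x y ≤ ENNReal.ofReal ((1/2 : ℝ) ^ m) := by
  rw [edist_dist]
  refine ENNReal.ofReal_le_ofReal ?_
  have := Int.abs_sub_lt_one_of_floor_eq_floor h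
  rw [← sub_mul, abs_mul, abs_of_pos (show (0:ℝ) < 2 ^ m by positivity)] at this
  rw [Real.dist_eq, one_div, inv_pow, ← one_div, le_div_iff₀ (by positivity)]
  exact this.le

theorem dy_near (m : ℕ) (x z : ℝ) (h : |x - z| < 1 / 2 ^ m) :
    dy m x ∈ Finset.Icc (dy m z - 1) (dy m z + 1) := by
  rw [lt_div_iff₀ (by positivity), ← abs_of_pos (show (0:ℝ) < 2 ^ m by positivity), ← abs_mul,
    sub_mul, abs_lt] at h
  have h1 := Int.floor_le (x * 2 ^ m)
  have h2 := Int.lt_floor_add_one (x * 2 ^ m)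
  have h3 := Int.floor_le (z * 2 ^ m)
  have h4 := Int.lt_floor_add_one (z * 2 ^ m)
  rw [Finset.mem_Icc]
  unfold dy
  generalize ⌊x * 2 ^ m⌋ = A at *
  generalize ⌊z * 2 ^ m⌋ = B at *
  constructor
  · have : (B : ℝ) < (A + 2 : ℤ) := by push_cast; linarith
    have := Int.cast_lt.1 this
    omega
  · have : (A : ℝ) < (B + 2 : ℤ) := by push_cast; linarith
    have := Int.cast_lt.1 this
    omega

theorem box_count (c : Set (ℝ × ℝ)) (s : ℝ) (h : upperBoxDim c < (s : EReal)) :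
    ∀ᶠ m : ℕ in atTop, ∃ P : Finset (ℤ × ℤ), (P.card : ℝ) ≤ 18 * 2 ^ ((m : ℝ) * s) ∧
      ∀ p ∈ c, (dy m p.1, dy m p.2) ∈ P := by
  classical
  have h1 := eventually_lt_of_limsup_lt h
  have h2 := (tendsto_pow_atTop_atTop_of_one_lt (one_lt_two : (1:ℕ) < 2)).eventually h1
  filter_upwards [h2, eventually_ge_atTop 1] with m hm hm1
  have hlog : 0 < Real.log ((2 ^ m : ℕ) : ℝ) := Real.log_pos (by
    exact_mod_cast Nat.one_lt_two_pow (by omega))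
  have hN : coveringNumber (1 / ((2 ^ m : ℕ) : ℝ)) c < ENNReal.ofReal (2 * 2 ^ ((m : ℝ) * s)) := by
    generalize coveringNumber (1 / ((2 ^ m : ℕ) : ℝ)) c = N at hm
    unfold elog at hm
    split_ifs at hm with hT
    · rw [EReal.top_mul_coe_of_pos (inv_pos.2 hlog)] at hm
      exact absurd hm (by simp)
    · rw [← EReal.coe_mul, EReal.coe_lt_coe_iff, ← div_eq_mul_inv, div_lt_iff₀ hlog] at hm
      rw [← ENNReal.ofReal_toReal hT]
      refine (ENNReal.ofReal_lt_ofReal_iff (by positivity)).2 ?_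
      rcases (ENNReal.toReal_nonneg (a := N)).eq_or_lt with h0 | h0
      · rw [← h0]; positivity
      · have : N.toReal < 2 ^ ((m : ℝ) * s) := by
          rw [← Real.log_lt_log_iff h0 (by positivity), Real.log_rpow (by norm_num)]
          push_cast at hm
          rw [Real.log_pow] at hm
          linarith
        have h3 : (0:ℝ) < 2 ^ ((m : ℝ) * s) := by positivity
        linarith
  unfold coveringNumber at hN
  obtain ⟨t, hN⟩ := iInf_lt_iff.1 hN
  obtain ⟨ht, hN⟩ := iInf_lt_iff.1 hN
  rw [← ENNReal.ofReal_natCast, ENNReal.ofReal_lt_ofReal_iff (by positivity)] at hN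
  refine ⟨t.biUnion fun z => Finset.Icc (dy m z.1 - 1) (dy m z.1 + 1) ×ˢ
    Finset.Icc (dy m z.2 - 1) (dy m z.2 + 1), ?_, ?_⟩
  · have : (t.biUnion fun z => Finset.Icc (dy m z.1 - 1) (dy m z.1 + 1) ×ˢ
      Finset.Icc (dy m z.2 - 1) (dy m z.2 + 1)).card ≤ t.card * 9 := by
      refine Finset.card_biUnion_le_card_mul _ _ _ fun z _ => ?_
      rw [Finset.card_product, Int.card_Icc, Int.card_Icc]
      have e : ∀ u : ℤ, (u + 1 + 1 - (u - 1)).toNat = 3 := fun u => by omega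
      rw [e, e]
    have : ((t.biUnion fun z => Finset.Icc (dy m z.1 - 1) (dy m z.1 + 1) ×ˢ
      Finset.Icc (dy m z.2 - 1) (dy m z.2 + 1)).card : ℝ) ≤ t.card * 9 := by exact_mod_cast this
    linarith
  · intro p hp
    have := ht hp
    simp only [Set.mem_iUnion] at this
    obtain ⟨z, hz, hpz⟩ := this
    rw [Metric.mem_ball, Prod.dist_eq, max_lt_iff, Real.dist_eq, Real.dist_eq] at hpz
    push_cast at hpz
    exact Finset.mem_biUnion.2 ⟨z, hz, Finset.mem_product.2 ⟨dy_near m _ _ hpz.1, dy_near m _ _ hpz.2⟩⟩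

theorem piece_split (c d : Set (ℝ × ℝ)) (s t a b : ℝ) (ha : 0 ≤ a) (hb : 0 ≤ b)
    (hc : upperBoxDim c < (s : EReal)) (hd : upperBoxDim d < (t : EReal)) (hst : s + t ≤ a + b) :
    ∃ E₁ E₂ : Set (ℝ × ℝ × ℝ),
      (∀ x : ℝ × ℝ × ℝ, (x.1, x.2.1) ∈ c → (x.1, x.2.2) ∈ d → x ∈ E₁ ∨ x ∈ E₂) ∧
      dimH ((fun p : ℝ × ℝ × ℝ => p.1) '' E₁) ≤ ENNReal.ofReal a ∧ dimH E₂ ≤ ENNReal.ofReal b := by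
  have hev : ∀ᶠ m : ℕ in atTop, ∃ (H : Finset ℤ) (L : Finset (ℤ × ℤ × ℤ)),
      (H.card : ℝ) ≤ 324 * 2 ^ ((m : ℝ) * a) ∧ (L.card : ℝ) ≤ 1 * 2 ^ ((m : ℝ) * b) ∧
      ∀ x : ℝ × ℝ × ℝ, (x.1, x.2.1) ∈ c → (x.1, x.2.2) ∈ d →
        dy m x.1 ∈ H ∨ (dy m x.1, dy m x.2.1, dy m x.2.2) ∈ L := by
    filter_upwards [box_count c s hc, box_count d t hd] with m ⟨P, hP, hPc⟩ ⟨Q, hQ, hQd⟩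
    obtain ⟨H, L, hH, hL, hHL⟩ := comb_split P Q (2 ^ ((m : ℝ) * b)) (by positivity)
    refine ⟨H, L, ?_, by simpa using hL, fun x hx hy => hHL _ _ _ (hPc _ hx) (hQd _ hy)⟩
    have h1 : (P.card : ℝ) * Q.card ≤ (18 * 2 ^ ((m : ℝ) * s)) * (18 * 2 ^ ((m : ℝ) * t)) := by
      gcongr
    have h2 : (18 * 2 ^ ((m : ℝ) * s)) * (18 * 2 ^ ((m : ℝ) * t)) = 324 * (2:ℝ) ^ ((m : ℝ) * (s + t)) := by
      rw [mul_add, Real.rpow_add (by norm_num)]; ring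
    have h3 : (2:ℝ) ^ ((m : ℝ) * (s + t)) ≤ (2:ℝ) ^ ((m : ℝ) * (a + b)) := by
      apply Real.rpow_le_rpow_of_exponent_le (by norm_num)
      gcongr
    rw [mul_add _ a b, Real.rpow_add (by norm_num)] at h3
    have h4 : (0:ℝ) < 2 ^ ((m : ℝ) * b) := by positivity
    refine le_of_mul_le_mul_right ?_ h4
    linarith
  obtain ⟨m0, hm0⟩ := eventually_atTop.1 hev
  have hall : ∀ m : ℕ, ∃ (H : Finset ℤ) (L : Finset (ℤ × ℤ × ℤ)), m ≥ m0 → (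
      (H.card : ℝ) ≤ 324 * 2 ^ ((m : ℝ) * a) ∧ (L.card : ℝ) ≤ 1 * 2 ^ ((m : ℝ) * b) ∧
      ∀ x : ℝ × ℝ × ℝ, (x.1, x.2.1) ∈ c → (x.1, x.2.2) ∈ d →
        dy m x.1 ∈ H ∨ (dy m x.1, dy m x.2.1, dy m x.2.2) ∈ L) := by
    intro m
    by_cases h : m ≥ m0
    · obtain ⟨H, L, h'⟩ := hm0 m h
      exact ⟨H, L, fun _ => h'⟩
    · exact ⟨∅, ∅, fun h' => absurd h' h⟩
  choose H L hHL using hall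
  refine ⟨{x | ∃ᶠ m in atTop, dy m x.1 ∈ H m},
    {x | ∃ᶠ m in atTop, (dy m x.1, dy m x.2.1, dy m x.2.2) ∈ L m}, ?_, ?_, ?_⟩
  · intro x hx hy
    have : ∃ᶠ m in atTop, dy m x.1 ∈ H m ∨ (dy m x.1, dy m x.2.1, dy m x.2.2) ∈ L m :=
      (eventually_atTop.2 ⟨m0, fun m hm => (hHL m hm).2.2 x hx hy⟩).frequently
    exact frequently_or_distrib.1 this
  · refine dim_limsup dy dy_edist H 324 a (by norm_num) ha m0 (fun m hm => (hHL m hm).1) _ ?_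
    rintro _ ⟨x, hx, rfl⟩
    exact hx
  · refine dim_limsup (fun m (x : ℝ × ℝ × ℝ) => (dy m x.1, dy m x.2.1, dy m x.2.2)) ?_ L 1 b
      (by norm_num) hb m0 (fun m hm => (hHL m hm).2.1) _ (fun x hx => hx)
    intro m x y h
    simp only [Prod.mk.injEq] at h
    rw [Prod.edist_eq, Prod.edist_eq]
    exact max_le (dy_edist _ _ _ h.1) (max_le (dy_edist _ _ _ h.2.1) (dy_edist _ _ _ h.2.2))

theorem upperBoxDim_nonneg {α : Type*} [PseudoMetricSpace α] (s : Set α) : 0 ≤ upperBoxDim s := by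
  refine le_limsup_of_frequently_le (Eventually.of_forall fun n => ?_).frequently
  refine mul_nonneg ?_ ?_
  · unfold elog
    split_ifs with hT
    · exact le_top
    · rw [EReal.coe_nonneg]
      by_cases h1 : coveringNumber (1 / n) s < 1
      · have h2 := h1
        unfold coveringNumber at h2
        obtain ⟨t, h2⟩ := iInf_lt_iff.1 h2
        obtain ⟨ht, h2⟩ := iInf_lt_iff.1 h2
        have h3 : t.card = 0 := by
          have : t.card < 1 := by exact_mod_cast h2
          omega
        have : coveringNumber (1 / n) s ≤ (t.card : ℝ≥0∞) := iInf₂_le t ht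
        rw [h3, Nat.cast_zero, nonpos_iff_eq_zero] at this
        rw [this]; simp
      · refine Real.log_nonneg ?_
        rw [← ENNReal.toReal_one]
        exact ENNReal.toReal_mono hT (not_lt.1 h1)
  · rw [EReal.coe_nonneg]
    exact inv_nonneg.2 (Real.log_natCast_nonneg n)

theorem packingDim_nonneg {α : Type*} [PseudoMetricSpace α] (s : Set α) : 0 ≤ packingDim s :=
  le_iInf₂ fun c _ => le_iSup_of_le 0 (upperBoxDim_nonneg (c 0))

theorem packingDim_lt {α : Type*} [PseudoMetricSpace α] (s : Set α) (r : EReal)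
    (h : packingDim s < r) : ∃ c : ℕ → Set α, s ⊆ ⋃ n, c n ∧ ∀ n, upperBoxDim (c n) < r := by
  unfold packingDim at h
  obtain ⟨c, h⟩ := iInf_lt_iff.1 h
  obtain ⟨hc, h⟩ := iInf_lt_iff.1 h
  exact ⟨c, hc, fun n => (le_iSup (fun n => upperBoxDim (c n)) n).trans_lt h⟩

theorem split_eps (S : Set (ℝ × ℝ × ℝ)) (a b : ℝ) (ha : 0 ≤ a) (hb : 0 ≤ b)
    (h : packingDim ((fun p : ℝ × ℝ × ℝ => (p.1, p.2.1)) '' S) +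
        packingDim ((fun p : ℝ × ℝ × ℝ => (p.1, p.2.2)) '' S) ≤ (a : EReal) + (b : EReal))
    (ε : ℝ) (hε : 0 < ε) :
    ∃ S' S'' : Set (ℝ × ℝ × ℝ), S ⊆ S' ∪ S'' ∧
      dimH ((fun p : ℝ × ℝ × ℝ => p.1) '' S') ≤ ENNReal.ofReal (a + ε) ∧
      dimH S'' ≤ ENNReal.ofReal b := by
  have hα0 := packingDim_nonneg ((fun p : ℝ × ℝ × ℝ => (p.1, p.2.1)) '' S)
  have hβ0 := packingDim_nonneg ((fun p : ℝ × ℝ × ℝ => (p.1, p.2.2)) '' S)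
  obtain ⟨s, t, hs, ht, hst⟩ : ∃ s t : ℝ,
      packingDim ((fun p : ℝ × ℝ × ℝ => (p.1, p.2.1)) '' S) < (s : EReal) ∧
      packingDim ((fun p : ℝ × ℝ × ℝ => (p.1, p.2.2)) '' S) < (t : EReal) ∧
      s + t ≤ (a + ε) + b := by
    generalize packingDim ((fun p : ℝ × ℝ × ℝ => (p.1, p.2.1)) '' S) = α at *
    generalize packingDim ((fun p : ℝ × ℝ × ℝ => (p.1, p.2.2)) '' S) = β at *
    have hα : α ≤ ((a + b : ℝ) : EReal) := by
      rw [EReal.coe_add]; exact (le_add_of_nonneg_right hβ0).trans h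
    have hβ : β ≤ ((a + b : ℝ) : EReal) := by
      rw [EReal.coe_add]; exact (le_add_of_nonneg_left hα0).trans h
    lift α to ℝ using ⟨(hα.trans_lt (EReal.coe_lt_top _)).ne,
      (lt_of_lt_of_le EReal.bot_lt_zero hα0).ne'⟩
    lift β to ℝ using ⟨(hβ.trans_lt (EReal.coe_lt_top _)).ne,
      (lt_of_lt_of_le EReal.bot_lt_zero hβ0).ne'⟩
    have h' : α + β ≤ a + b := by exact_mod_cast h
    refine ⟨α + ε / 2, β + ε / 2, ?_, ?_, by linarith⟩
    · rw [EReal.coe_lt_coe_iff]; linarith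
    · rw [EReal.coe_lt_coe_iff]; linarith
  obtain ⟨c, hcS, hc⟩ := packingDim_lt _ _ hs
  obtain ⟨d, hdS, hd⟩ := packingDim_lt _ _ ht
  have := fun i j => piece_split (c i) (d j) s t (a + ε) b (by linarith) hb (hc i) (hd j) hst
  choose E₁ E₂ hE h1 h2 using this
  refine ⟨⋃ i, ⋃ j, E₁ i j, ⋃ i, ⋃ j, E₂ i j, ?_, ?_, ?_⟩
  · intro x hx
    obtain ⟨i, hi⟩ := Set.mem_iUnion.1 (hcS ⟨x, hx, rfl⟩)
    obtain ⟨j, hj⟩ := Set.mem_iUnion.1 (hdS ⟨x, hx, rfl⟩)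
    rcases hE i j x hi hj with h | h
    · exact Or.inl (Set.mem_iUnion₂.2 ⟨i, j, h⟩)
    · exact Or.inr (Set.mem_iUnion₂.2 ⟨i, j, h⟩)
  · simp only [Set.image_iUnion, dimH_iUnion]
    exact iSup₂_le h1
  · simp only [dimH_iUnion]
    exact iSup₂_le h2

/-- If `dim_p S₁₂ + dim_p S₁₃ ≤ a + b`, then `S` splits as `S' ∪ S''` with
`dim_H S'₁ ≤ a` and `dim_H S'' ≤ b`. -/
theorem splitting_dimensions (S : Set (ℝ × ℝ × ℝ)) (a b : ℝ) (ha : 0 ≤ a) (hb : 0 ≤ b)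
    (h : packingDim ((fun p : ℝ × ℝ × ℝ => (p.1, p.2.1)) '' S) +
        packingDim ((fun p : ℝ × ℝ × ℝ => (p.1, p.2.2)) '' S) ≤ (a : EReal) + (b : EReal)) :
    ∃ S' S'' : Set (ℝ × ℝ × ℝ), S = S' ∪ S'' ∧
      dimH ((fun p : ℝ × ℝ × ℝ => p.1) '' S') ≤ ENNReal.ofReal a ∧
      dimH S'' ≤ ENNReal.ofReal b := by
  have := fun k : ℕ => split_eps S a b ha hb h (1 / ((k : ℝ) + 1)) (by positivity)
  choose A B hAB hA hB using this
  refine ⟨S ∩ ⋂ k, A k, S ∩ ⋃ k, B k, ?_, ?_, ?_⟩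
  · ext x
    constructor
    · intro hx
      by_cases hx' : ∃ k, x ∈ B k
      · exact Or.inr ⟨hx, Set.mem_iUnion.2 hx'⟩
      · push Not at hx'
        exact Or.inl ⟨hx, Set.mem_iInter.2 fun k => (hAB k hx).resolve_right (hx' k)⟩
    · rintro (hx | hx) <;> exact hx.1
  · have hk : ∀ k : ℕ, dimH ((fun p : ℝ × ℝ × ℝ => p.1) '' (S ∩ ⋂ k, A k)) ≤
        ENNReal.ofReal (a + 1 / ((k : ℝ) + 1)) := fun k =>
      (dimH_mono (Set.image_mono fun x hx => Set.mem_iInter.1 hx.2 k)).trans (hA k)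
    have hl : Tendsto (fun k : ℕ => ENNReal.ofReal (a + 1 / ((k : ℝ) + 1))) atTop
        (𝓝 (ENNReal.ofReal a)) := by
      refine (ENNReal.continuous_ofReal.tendsto a).comp ?_
      simpa using (tendsto_one_div_add_atTop_nhds_zero_nat (𝕜 := ℝ)).const_add a
    exact ge_of_tendsto' hl hk
  · refine (dimH_mono Set.inter_subset_right).trans ?_
    rw [dimH_iUnion]
    exact iSup_le hB
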